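/- Let γ > 0, m ≥ 0, and α ≥ (1 + log₂(m+2))·γ. Let N ≥ 2, let a ≥ 0, and let e_1 ≥ e_2 ≥ ⋯ ≥ e_{N−1} > 0 be real numbers satisfying the γ-th monogamy relation a^γ ≥ Σ_{i=1}^{N−1} e_i^γ. For i = 2, …, N−1 set τ_i = (e_1^γ + ⋯ + e_{i−1}^γ) / e_i^γ. Then a^α ≥ e_1^α + Σ_{i=2}^{N−1} [ i^(α/γ) − (i−1)^(α/γ) + (i−1)^(−α/γ) − τ_i^(−α/γ) ]·e_i^α + Σ_{i=2}^{N−1} (m·α/γ)·( τ_i − (i−1) )·e_i^α. -/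

import Mathlib

lemma aux_diff (p x : ℝ) (hp : 1 ≤ p) (hx : 1 ≤ x) :
    (2:ℝ) ^ p - 1 ≤ (1 + x) ^ p - x ^ p := by
  have hd : ∀ y : ℝ, 1 ≤ y → HasDerivAt (fun y : ℝ => (1 + y) ^ p - y ^ p)
      (1 * p * (1 + y) ^ (p - 1) - 1 * p * y ^ (p - 1)) y := by
    intro y hy
    have h1 : HasDerivAt (fun y : ℝ => 1 + y) 1 y := (hasDerivAt_id y).const_add 1
    exact (h1.rpow_const (Or.inr hp)).sub ((hasDerivAt_id y).rpow_const (Or.inr hp))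
  have hm : MonotoneOn (fun y : ℝ => (1 + y) ^ p - y ^ p) (Set.Ici 1) := by
    apply monotoneOn_of_deriv_nonneg (convex_Ici 1)
    · intro y hy
      exact (hd y hy).continuousAt.continuousWithinAt
    · intro y hy
      rw [interior_Ici] at hy
      exact (hd y (le_of_lt hy)).differentiableAt.differentiableWithinAt
    · intro y hy
      rw [interior_Ici] at hy
      have hy' : (1:ℝ) < y := hy
      rw [(hd y hy'.le).deriv]
      have : y ^ (p - 1) ≤ (1 + y) ^ (p - 1) :=
        Real.rpow_le_rpow (by linarith) (by linarith) (by linarith)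
      nlinarith
  have := hm (Set.mem_Ici.2 le_rfl) (Set.mem_Ici.2 hx) hx
  simp only [Real.one_rpow] at this
  norm_num at this ⊢
  linarith

lemma aux_key (s m k x : ℝ) (hs : 2 ≤ s) (hms : m + 2 ≤ (2:ℝ) ^ (s - 1))
    (hk : 1 ≤ k) (hx : k ≤ x) :
    (k + 1) ^ s - k ^ s + k ^ (-s) - x ^ (-s) + m * s * (x - k) ≤ (1 + x) ^ s - x ^ s := by
  have hd : ∀ y : ℝ, 1 ≤ y →
      HasDerivAt (fun y : ℝ => (1 + y) ^ s - y ^ s + y ^ (-s) - m * s * y)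
      (1 * s * (1 + y) ^ (s - 1) - 1 * s * y ^ (s - 1) + 1 * (-s) * y ^ (-s - 1) - m * s * 1) y := by
    intro y hy
    have h1 : HasDerivAt (fun y : ℝ => 1 + y) 1 y := (hasDerivAt_id y).const_add 1
    have h0 := hasDerivAt_id y
    exact (((h1.rpow_const (Or.inr (by linarith))).sub
      (h0.rpow_const (Or.inr (by linarith)))).add
      (h0.rpow_const (Or.inl (by simp only [id]; linarith)))).sub (h0.const_mul (m * s))
  have hm : MonotoneOn (fun y : ℝ => (1 + y) ^ s - y ^ s + y ^ (-s) - m * s * y) (Set.Ici 1) := by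
    apply monotoneOn_of_deriv_nonneg (convex_Ici 1)
    · intro y hy
      exact (hd y hy).continuousAt.continuousWithinAt
    · intro y hy
      rw [interior_Ici] at hy
      exact (hd y (le_of_lt hy)).differentiableAt.differentiableWithinAt
    · intro y hy
      rw [interior_Ici] at hy
      have hy' : (1:ℝ) < y := hy
      rw [(hd y hy'.le).deriv]
      have h1 := aux_diff (s - 1) y (by linarith) hy'.le
      have h2 : y ^ (-s - 1) ≤ 1 := Real.rpow_le_one_of_one_le_of_nonpos hy'.le (by linarith)
      have h3 : 0 ≤ (1 + y) ^ (s - 1) - y ^ (s - 1) - y ^ (-s - 1) - m := by linarith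
      have h4 := mul_nonneg (by linarith : (0:ℝ) ≤ s) h3
      linarith
  have := hm (Set.mem_Ici.2 hk) (Set.mem_Ici.2 (hk.trans hx)) hx
  simp only at this
  rw [add_comm k 1]
  linarith

/-- Theorem 3.6: tighter α-th monogamy relation for N-partite states, with the
bipartite measures `e 1 ≥ e 2 ≥ ⋯ ≥ e (N-1) > 0` arranged in descending order and
`τ_i = (e_1^γ + ⋯ + e_{i-1}^γ)/e_i^γ`. Here `a` plays the role of
`E(ρ_{A|B_1 ⋯ B_{N-1}})`. -/
theorem tighter_monogamy_descending (γ m α a : ℝ) (N : ℕ) (e : ℕ → ℝ)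
    (hγ : 0 < γ) (hm : 0 ≤ m)
    (hα : (1 + Real.logb 2 (m + 2)) * γ ≤ α)
    (hN : 2 ≤ N) (ha : 0 ≤ a)
    (hpos : ∀ i, 1 ≤ i → i ≤ N - 1 → 0 < e i)
    (hdec : ∀ i, 1 ≤ i → i + 1 ≤ N - 1 → e (i + 1) ≤ e i)
    (hmono : a ^ γ ≥ ∑ i ∈ Finset.Icc 1 (N - 1), e i ^ γ) :
    a ^ α ≥
      e 1 ^ α
      + ∑ i ∈ Finset.Icc 2 (N - 1),
          ((i : ℝ) ^ (α / γ) - ((i : ℝ) - 1) ^ (α / γ) + ((i : ℝ) - 1) ^ (-(α / γ))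
            - ((∑ j ∈ Finset.Icc 1 (i - 1), e j ^ γ) / e i ^ γ) ^ (-(α / γ)))
          * e i ^ α
      + ∑ i ∈ Finset.Icc 2 (N - 1),
          m * α / γ
            * ((∑ j ∈ Finset.Icc 1 (i - 1), e j ^ γ) / e i ^ γ - ((i : ℝ) - 1))
          * e i ^ α := by
  have hlog : 1 ≤ Real.logb 2 (m + 2) := by
    rw [Real.le_logb_iff_rpow_le (by norm_num) (by linarith)]
    rw [Real.rpow_one]; linarith
  have hs1 : 1 + Real.logb 2 (m + 2) ≤ α / γ := by
    rwa [le_div_iff₀ hγ]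
  have hαs : α = γ * (α / γ) := by field_simp
  have hmα : m * α / γ = m * (α / γ) := by ring
  rw [hmα]
  generalize α / γ = s at hαs hs1
  subst hαs
  have hs : 2 ≤ s := by linarith
  have hms : m + 2 ≤ (2:ℝ) ^ (s - 1) := by
    rw [← Real.logb_le_iff_le_rpow (by norm_num) (by linarith)]
    linarith
  have main : ∀ n : ℕ, 1 ≤ n → n ≤ N - 1 →
      e 1 ^ (γ * s)
      + ∑ i ∈ Finset.Icc 2 n,
          ((i : ℝ) ^ s - ((i : ℝ) - 1) ^ s + ((i : ℝ) - 1) ^ (-s)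
            - ((∑ j ∈ Finset.Icc 1 (i - 1), e j ^ γ) / e i ^ γ) ^ (-s))
          * e i ^ (γ * s)
      + ∑ i ∈ Finset.Icc 2 n,
          m * s
            * ((∑ j ∈ Finset.Icc 1 (i - 1), e j ^ γ) / e i ^ γ - ((i : ℝ) - 1))
          * e i ^ (γ * s) ≤ (∑ j ∈ Finset.Icc 1 n, e j ^ γ) ^ s := by
    intro n hn
    induction n, hn using Nat.le_induction with
    | base =>
      intro h
      simp [Real.rpow_mul (hpos 1 le_rfl h).le]
    | succ n hn ih =>
      intro h
      have ih := ih (by omega)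
      rw [Finset.sum_Icc_succ_top (by omega), Finset.sum_Icc_succ_top (by omega),
        Finset.sum_Icc_succ_top (by omega)]
      have he : 0 < e (n + 1) := hpos _ (by omega) h
      have hanti : ∀ k, n + 1 ≤ N - 1 → ∀ j, 1 ≤ j → j + k = n + 1 → e (n + 1) ≤ e j := by
        intro k hk
        induction k with
        | zero => intro j hj hjk; rw [← hjk]; simp
        | succ k ihk =>
          intro j hj hjk
          exact (ihk (j + 1) (by omega) (by omega)).trans (hdec j hj (by omega))
      have hE : 0 < e (n + 1) ^ γ := Real.rpow_pos_of_pos he γ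
      have hS : (n : ℝ) * e (n + 1) ^ γ ≤ ∑ j ∈ Finset.Icc 1 n, e j ^ γ := by
        have := Finset.card_nsmul_le_sum (Finset.Icc 1 n) (fun j => e j ^ γ) (e (n + 1) ^ γ) (by
          intro j hj
          rw [Finset.mem_Icc] at hj
          exact Real.rpow_le_rpow he.le
            (hanti (n + 1 - j) h j hj.1 (by omega)) hγ.le)
        simpa using this
      simp only [Nat.add_sub_cancel]
      push_cast
      rw [add_sub_cancel_right, Real.rpow_mul he.le]
      generalize (∑ j ∈ Finset.Icc 1 n, e j ^ γ) = S at *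
      generalize e (n + 1) ^ γ = E at *
      have hn1 : (1:ℝ) ≤ n := by exact_mod_cast hn
      have hx : (n:ℝ) ≤ S / E := by rwa [le_div_iff₀ hE]
      have key := aux_key s m n (S / E) hs hms hn1 hx
      have hEs : 0 < E ^ s := Real.rpow_pos_of_pos hE s
      have key2 := mul_le_mul_of_nonneg_right key hEs.le
      have h1 : (1 + S / E) ^ s * E ^ s = (S + E) ^ s := by
        rw [← Real.mul_rpow (by linarith) hE.le]
        congr 1
        field_simp
        ring
      have h2 : (S / E) ^ s * E ^ s = S ^ s := by
        rw [← Real.mul_rpow (by linarith) hE.le]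
        congr 1
        field_simp
      rw [sub_mul _ _ (E ^ s), h1, h2] at key2
      linarith
  have h1 := main (N - 1) (by omega) le_rfl
  have h2 : (∑ j ∈ Finset.Icc 1 (N - 1), e j ^ γ) ^ s ≤ a ^ (γ * s) := by
    rw [Real.rpow_mul ha]
    apply Real.rpow_le_rpow _ hmono (by linarith)
    apply Finset.sum_nonneg
    intro j hj
    rw [Finset.mem_Icc] at hj
    exact Real.rpow_nonneg (hpos j hj.1 hj.2).le γ
  exact h1.trans h2
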